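/- Let H be a finite-dimensional complex inner product space, let C be a unitary operator on ℂ² ⊗ H, and let Υ, Φ be linear operators on H such that C(|0⟩ ⊗ v) = |0⟩ ⊗ (Υ v) + |1⟩ ⊗ (Φ v) for all v ∈ H. Fix φ ∈ ℝ, let P_φ := e^{iφ}|0⟩⟨0| + |1⟩⟨1|, set S̃ := C† (P_φ ⊗ I) C and Q := Υ†Υ. Let Π₀ be an orthogonal projection on H with Q Π₀ = Π₀ Q = Π₀, and suppose ‖Q − Π₀‖ ≤ ε² for some ε ∈ (0,1). Define E_φ : H → ℂ² ⊗ H by E_φ v := S̃(|0⟩ ⊗ v) − |0⟩ ⊗ (S_φ(Π₀) v), where S_φ(Π₀) := I + (e^{iφ} − 1)Π₀. Then ‖E_φ‖ ≤ |e^{iφ} − 1| · ε ≤ 2ε. -/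

import Mathlib

/- We model the tensor product `ℂ² ⊗ H` by the L²-product `WithLp 2 (H × H)`,
identifying `|0⟩ ⊗ v` with `(v, 0)` and `|1⟩ ⊗ v` with `(0, v)`. -/

noncomputable section

variable {H : Type*} [NormedAddCommGroup H] [InnerProductSpace ℂ H]

/-- The embedding `|0⟩ ⊗ I : H → ℂ² ⊗ H`, `v ↦ |0⟩ ⊗ v`. -/
def ket0 : H →L[ℂ] WithLp 2 (H × H) :=
  (WithLp.prodContinuousLinearEquiv 2 ℂ H H).symm.toContinuousLinearMap.comp
    (ContinuousLinearMap.inl ℂ H H)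

/-- The embedding `|1⟩ ⊗ I : H → ℂ² ⊗ H`, `v ↦ |1⟩ ⊗ v`. -/
def ket1 : H →L[ℂ] WithLp 2 (H × H) :=
  (WithLp.prodContinuousLinearEquiv 2 ℂ H H).symm.toContinuousLinearMap.comp
    (ContinuousLinearMap.inr ℂ H H)

/-- The block projection `⟨0| ⊗ I : ℂ² ⊗ H → H`, `|k⟩ ⊗ v ↦ δ_{0k} v`. -/
def bra0 : WithLp 2 (H × H) →L[ℂ] H :=
  (ContinuousLinearMap.fst ℂ H H).comp
    (WithLp.prodContinuousLinearEquiv 2 ℂ H H).toContinuousLinearMap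

/-- The block projection `⟨1| ⊗ I : ℂ² ⊗ H → H`, `|k⟩ ⊗ v ↦ δ_{1k} v`. -/
def bra1 : WithLp 2 (H × H) →L[ℂ] H :=
  (ContinuousLinearMap.snd ℂ H H).comp
    (WithLp.prodContinuousLinearEquiv 2 ℂ H H).toContinuousLinearMap

/-- The phase gate `P_φ ⊗ I = (e^{iφ}|0⟩⟨0| + |1⟩⟨1|) ⊗ I` on `ℂ² ⊗ H`. -/
def phaseGate (φ : ℝ) : WithLp 2 (H × H) →L[ℂ] WithLp 2 (H × H) :=
  Complex.exp ((φ : ℂ) * Complex.I) • ((ket0 (H := H)).comp bra0) + (ket1 (H := H)).comp bra1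

theorem norm_sq_ket0_add_ket1 (a b : H) :
    ‖ket0 a + ket1 b‖ ^ 2 = ‖a‖ ^ 2 + ‖b‖ ^ 2 := by
  rw [WithLp.prod_norm_sq_eq_of_L2]
  simp [ket0, ket1]

theorem phaseGate_apply (φ : ℝ) (x : WithLp 2 (H × H)) :
    phaseGate φ x = x + (Complex.exp ((φ : ℂ) * Complex.I) - 1) • ket0 (bra0 x) := by
  have hx : x = ket0 (bra0 x) + ket1 (bra1 x) := by
    refine WithLp.ofLp_injective 2 (Prod.ext ?_ ?_) <;>
      simp [ket0, ket1, bra0, bra1]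
  conv_rhs => enter [1]; rw [hx]
  simp only [phaseGate, add_apply, smul_apply,
    ContinuousLinearMap.comp_apply]
  module

theorem bra0_ket0_add_ket1 (a b : H) : bra0 (ket0 a + ket1 b) = a := by
  simp [ket0, ket1, bra0]

/-- **Operator-norm bound on the selective-phase error.**
Under the hypotheses of the error-operator identity, if moreover `‖Q − Π₀‖ ≤ ε²`
with `ε ∈ (0,1)`, then `‖E_φ‖ ≤ |e^{iφ} − 1| ε ≤ 2ε`. -/
theorem compiled_selective_phase_error_norm_bound
    {H : Type*} [NormedAddCommGroup H] [InnerProductSpace ℂ H] [FiniteDimensional ℂ H]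
    (C : WithLp 2 (H × H) →L[ℂ] WithLp 2 (H × H))
    (hC : C ∈ unitary (WithLp 2 (H × H) →L[ℂ] WithLp 2 (H × H)))
    (Υ Φ : H →L[ℂ] H)
    (hblock : ∀ v : H, C (ket0 v) = ket0 (Υ v) + ket1 (Φ v))
    (φ : ℝ)
    (Stilde : WithLp 2 (H × H) →L[ℂ] WithLp 2 (H × H))
    (hS : Stilde = ContinuousLinearMap.adjoint C * phaseGate φ * C)
    (Q : H →L[ℂ] H) (hQ : Q = ContinuousLinearMap.adjoint Υ * Υ)
    (Pi0 : H →L[ℂ] H)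
    (hPi0idem : Pi0 * Pi0 = Pi0) (hPi0sa : ContinuousLinearMap.adjoint Pi0 = Pi0)
    (hQPi0 : Q * Pi0 = Pi0) (hPi0Q : Pi0 * Q = Pi0)
    (ε : ℝ) (hε0 : 0 < ε) (hε1 : ε < 1)
    (hQnear : ‖Q - Pi0‖ ≤ ε ^ 2)
    (Ephi : H →L[ℂ] WithLp 2 (H × H))
    (hE : ∀ v : H, Ephi v =
      Stilde (ket0 v) - ket0 ((1 + (Complex.exp ((φ : ℂ) * Complex.I) - 1) • Pi0) v)) :
    ‖Ephi‖ ≤ ‖Complex.exp ((φ : ℂ) * Complex.I) - 1‖ * ε ∧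
    ‖Complex.exp ((φ : ℂ) * Complex.I) - 1‖ * ε ≤ 2 * ε := by
  set c := Complex.exp ((φ : ℂ) * Complex.I) - 1 with hc
  have hCC (x : WithLp 2 (H × H)) : ContinuousLinearMap.adjoint C (C x) = x :=
    DFunLike.congr_fun (Unitary.star_mul_self_of_mem hC) x
  have hCC' (x : WithLp 2 (H × H)) : C (ContinuousLinearMap.adjoint C x) = x :=
    DFunLike.congr_fun (Unitary.mul_star_self_of_mem hC) x
  have hCnorm (x : WithLp 2 (H × H)) : ‖C x‖ = ‖x‖ :=
    ContinuousLinearMap.norm_map_of_mem_unitary hC x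
  have hQP (v : H) : Q (Pi0 v) = Pi0 v := DFunLike.congr_fun hQPi0 v
  have hPQ (v : H) : Pi0 (Q v) = Pi0 v := DFunLike.congr_fun hPi0Q v
  have hPP (v : H) : Pi0 (Pi0 v) = Pi0 v := DFunLike.congr_fun hPi0idem v
  have hΥ (x : H) : ‖Υ x‖ ^ 2 = RCLike.re (inner ℂ x (Q x)) := by
    rw [hQ, ContinuousLinearMap.mul_def, ContinuousLinearMap.comp_apply, ContinuousLinearMap.adjoint_inner_right,
      inner_self_eq_norm_sq]
  have hΦ (v : H) : Φ (Pi0 v) = 0 := by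
    have h1 := norm_sq_ket0_add_ket1 (Υ (Pi0 v)) (Φ (Pi0 v))
    have h2 := norm_sq_ket0_add_ket1 (Pi0 v) 0
    have h3 := hΥ (Pi0 v)
    rw [hQP, inner_self_eq_norm_sq] at h3
    rw [← hblock, hCnorm] at h1
    simp only [map_zero, add_zero, norm_zero] at h2
    have h4 : ‖Φ (Pi0 v)‖ ^ 2 = 0 := by linarith
    simpa using h4
  have hΥle (v : H) : ‖Υ (v - Pi0 v)‖ ^ 2 ≤ (ε * ‖v‖) ^ 2 := by
    have hcross : inner ℂ (Pi0 v) ((Q - Pi0) v) = 0 := by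
      rw [← hPi0sa, ContinuousLinearMap.adjoint_inner_left, hPi0sa]
      simp [hPQ, hPP]
    have hQx : Q (v - Pi0 v) = (Q - Pi0) v := by simp [hQP]
    rw [hΥ, hQx, inner_sub_left, hcross, sub_zero]
    calc RCLike.re (inner ℂ v ((Q - Pi0) v))
        ≤ ‖v‖ * ‖(Q - Pi0) v‖ := re_inner_le_norm _ _
      _ ≤ ‖v‖ * (ε ^ 2 * ‖v‖) := by
          gcongr
          exact (Q - Pi0).le_of_opNorm_le hQnear v
      _ = (ε * ‖v‖) ^ 2 := by ring
  have hEv (v : H) :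
      Ephi v = c • (ContinuousLinearMap.adjoint C (ket0 (Υ v)) - ket0 (Pi0 v)) := by
    rw [hE, hS]
    simp only [ContinuousLinearMap.mul_def, ContinuousLinearMap.comp_apply, phaseGate_apply, map_add, map_smul, hCC,
      add_apply, smul_apply,
      one_apply_eq_self, ← hc]
    rw [hblock, bra0_ket0_add_ket1]
    module
  have hCw (v : H) : C (ContinuousLinearMap.adjoint C (ket0 (Υ v)) - ket0 (Pi0 v)) =
      ket0 (Υ (v - Pi0 v)) + ket1 0 := by
    rw [map_sub, hCC', hblock, hΦ]
    simp
  refine ⟨ContinuousLinearMap.opNorm_le_bound _ (by positivity) fun v => ?_, ?_⟩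
  · rw [hEv, norm_smul, mul_assoc]
    gcongr
    refine le_of_sq_le_sq ?_ (by positivity)
    rw [← hCnorm, hCw, norm_sq_ket0_add_ket1]
    simpa using hΥle v
  · gcongr
    calc ‖c‖ ≤ ‖Complex.exp ((φ : ℂ) * Complex.I)‖ + ‖(1 : ℂ)‖ := norm_sub_le _ _
      _ = 2 := by rw [Complex.norm_exp_ofReal_mul_I]; norm_num
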